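/- Let d be a positive rational with √d irrational, let a, b ∈ ℚ[√d] with 1 < ā < a and b > 1, and suppose the standard trapezoid t(b) admits a trivial tiling by homothetic copies of the standard trapezoid t(a). Then: (i) 1 < b̄ < b; (ii) b̄/b ≥ ā/a; (iii) ln G(b) / ln G(b̄) ≥ ln G(a) / ln G(ā), where G(x) = (x−1)/(x+1). -/

import Mathlib

noncomputable section

/-- The homothetic copy of a plane figure `S` under `x ↦ r • x + v`. -/
def homothety (r : ℝ) (v : ℝ × ℝ) (S : Set (ℝ × ℝ)) : Set (ℝ × ℝ) :=
  (fun x : ℝ × ℝ => (r * x.1 + v.1, r * x.2 + v.2)) '' S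

/-- `S` is tiled by homothetic copies of figures from the family `F`:
`S` is a union of finitely many homothetic copies of members of `F`
whose interiors are pairwise disjoint. -/
def IsTiling (S : Set (ℝ × ℝ)) (F : Set (Set (ℝ × ℝ))) : Prop :=
  ∃ (n : ℕ) (r : Fin n → ℝ) (v : Fin n → ℝ × ℝ) (t : Fin n → Set (ℝ × ℝ)),
    (∀ i, t i ∈ F) ∧ (∀ i, 0 < r i) ∧
    S = ⋃ i, homothety (r i) (v i) (t i) ∧
    ∀ i j, i ≠ j →
      interior (homothety (r i) (v i) (t i)) ∩ interior (homothety (r j) (v j) (t j)) = ∅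
/-- The standard trapezoid `t(a)`: unit height, horizontal bases `a+1` and `a-1`,
base angles `45°`, midline `a`. -/
def stdTrap (a : ℝ) : Set (ℝ × ℝ) :=
  convexHull ℝ ({(0, 0), (a + 1, 0), (a, 1), (1, 1)} : Set (ℝ × ℝ))

/-- The standard parallelogram `p(a)`: unit height, horizontal bases of length `a`. -/
def stdPar (a : ℝ) : Set (ℝ × ℝ) :=
  convexHull ℝ ({(0, 0), (a, 0), (a + 1, 1), (1, 1)} : Set (ℝ × ℝ))
/-- `S` admits a trivial tiling by homothetic copies of members of `F`: either it is a
single homothetic copy of a member of `F`, or some line segment divides it into two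
figures, each admitting a trivial tiling. -/
inductive TrivialTiling (F : Set (Set (ℝ × ℝ))) : Set (ℝ × ℝ) → Prop
  | single (r : ℝ) (v : ℝ × ℝ) (t : Set (ℝ × ℝ)) :
      0 < r → t ∈ F → TrivialTiling F (homothety r v t)
  | split (S S₁ S₂ : Set (ℝ × ℝ)) (x y : ℝ × ℝ) :
      TrivialTiling F S₁ → TrivialTiling F S₂ →
      S = S₁ ∪ S₂ → interior S₁ ∩ interior S₂ = ∅ →
      S₁ ∩ S₂ ⊆ segment ℝ x y →
      TrivialTiling F S
/-- `G(x) = (x-1)/(x+1)`. -/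
def Gfun (x : ℝ) : ℝ := (x - 1) / (x + 1)

/-- Trapezoid by inequalities. -/
def TrapR (p q u w : ℝ) : Set (ℝ × ℝ) :=
  {z | u ≤ z.2 ∧ z.2 ≤ w ∧ p + z.2 ≤ z.1 ∧ z.1 + z.2 ≤ q}

lemma TrapR_convex (p q u w : ℝ) : Convex ℝ (TrapR p q u w) := by
  intro x hx y hy s t hs ht hst
  obtain ⟨h1, h2, h3, h4⟩ := hx
  obtain ⟨k1, k2, k3, k4⟩ := hy
  have e : t = 1 - s := by linarith
  subst e
  refine ⟨?_, ?_, ?_, ?_⟩ <;> simp only [Prod.fst_add, Prod.snd_add, Prod.smul_fst, Prod.smul_snd, smul_eq_mul] <;> nlinarith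

lemma TrapR_closed (p q u w : ℝ) : IsClosed (TrapR p q u w) := by
  have : TrapR p q u w = {z | u ≤ z.2} ∩ {z | z.2 ≤ w} ∩ {z | p + z.2 ≤ z.1} ∩ {z | z.1 + z.2 ≤ q} := by
    ext z; simp [TrapR, and_assoc]
  rw [this]
  refine ((IsClosed.inter ?_ ?_).inter ?_).inter ?_
  · exact isClosed_le (by fun_prop) (by fun_prop)
  · exact isClosed_le (by fun_prop) (by fun_prop)
  · exact isClosed_le (by fun_prop) (by fun_prop)
  · exact isClosed_le (by fun_prop) (by fun_prop)

lemma TrapR_interior (p q u w : ℝ) (z : ℝ × ℝ) (h1 : u < z.2) (h2 : z.2 < w)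
    (h3 : p + z.2 < z.1) (h4 : z.1 + z.2 < q) : z ∈ interior (TrapR p q u w) := by
  rw [mem_interior]
  refine ⟨{z | u < z.2} ∩ {z | z.2 < w} ∩ {z | p + z.2 < z.1} ∩ {z | z.1 + z.2 < q}, ?_, ?_, ?_⟩
  · rintro y ⟨⟨⟨a, b⟩, c⟩, d⟩
    exact ⟨le_of_lt a, le_of_lt b, le_of_lt c, le_of_lt d⟩
  · refine ((IsOpen.inter ?_ ?_).inter ?_).inter ?_
    · exact isOpen_lt (by fun_prop) (by fun_prop)
    · exact isOpen_lt (by fun_prop) (by fun_prop)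
    · exact isOpen_lt (by fun_prop) (by fun_prop)
    · exact isOpen_lt (by fun_prop) (by fun_prop)
  · exact ⟨⟨⟨h1, h2⟩, h3⟩, h4⟩

lemma stdTrap_eq (a : ℝ) (ha : 1 < a) : stdTrap a = TrapR 0 (a + 1) 0 1 := by
  apply Set.Subset.antisymm
  · apply convexHull_min _ (TrapR_convex _ _ _ _)
    rintro z (rfl | rfl | rfl | rfl) <;> refine ⟨?_, ?_, ?_, ?_⟩ <;> simp <;> linarith
  · rintro ⟨x, y⟩ ⟨h1, h2, h3, h4⟩
    simp only at h1 h2 h3 h4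
    have hc : Convex ℝ (stdTrap a) := convex_convexHull _ _
    have m : ∀ z ∈ ({(0, 0), (a + 1, 0), (a, 1), (1, 1)} : Set (ℝ × ℝ)), z ∈ stdTrap a :=
      fun z hz => subset_convexHull ℝ _ hz
    have m1 := m (0, 0) (by simp)
    have m2 := m (a + 1, 0) (by simp)
    have m3 := m (a, 1) (by simp)
    have m4 := m (1, 1) (by simp)
    have l := hc m1 m4 (sub_nonneg.2 h2) h1 (by ring)
    have r := hc m2 m3 (sub_nonneg.2 h2) h1 (by ring)
    obtain ⟨D, hD⟩ : ∃ D, D = a + 1 - 2 * y := ⟨_, rfl⟩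
    have hpos : 0 < D := by linarith
    have hne : D ≠ 0 := hpos.ne'
    have c1 : 0 ≤ (D + y - x) / D := div_nonneg (by linarith) hpos.le
    have c2 : 0 ≤ (x - y) / D := div_nonneg (by linarith) hpos.le
    have f := hc l r c1 c2 (by field_simp; ring)
    convert f using 1
    have ea : a = D + 2 * y - 1 := by linarith
    rw [ea]
    ext
    · simp
      field_simp
      ring
    · simp
      field_simp
      ring

lemma homothety_TrapR (r : ℝ) (hr : 0 < r) (v : ℝ × ℝ) (p q u w : ℝ) :
    homothety r v (TrapR p q u w) =
      TrapR (r * p + v.1 - v.2) (r * q + v.1 + v.2) (r * u + v.2) (r * w + v.2) := by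
  ext z
  constructor
  · rintro ⟨y, ⟨h1, h2, h3, h4⟩, rfl⟩
    refine ⟨?_, ?_, ?_, ?_⟩ <;> simp only <;> nlinarith
  · rintro ⟨h1, h2, h3, h4⟩
    refine ⟨((z.1 - v.1) / r, (z.2 - v.2) / r), ⟨?_, ?_, ?_, ?_⟩, ?_⟩
    · simp only; rw [le_div_iff₀ hr]; linarith
    · simp only; rw [div_le_iff₀ hr]; linarith
    · simp only; rw [le_div_iff₀ hr, add_mul, div_mul_cancel₀ _ hr.ne']; linarith
    · simp only; rw [← add_div, div_le_iff₀ hr]; linarith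
    · ext <;> simp <;> field_simp <;> ring

lemma mid_mem {S : Set (ℝ × ℝ)} (hS : Convex ℝ S) {x y x' y' : ℝ} (h : (x, y) ∈ S)
    (h' : (x', y') ∈ S) : ((x + x') / 2, (y + y') / 2) ∈ S := by
  have := hS h h' (by norm_num : (0 : ℝ) ≤ 1 / 2) (by norm_num : (0 : ℝ) ≤ 1 / 2) (by norm_num)
  convert this using 1
  ext <;> simp <;> ring

lemma no_overlap {p q u w p' q' u' w' : ℝ}
    (h2 : p + 2 * w < q) (h2' : p' + 2 * w' < q')
    (hc : Convex ℝ (TrapR p q u w ∪ TrapR p' q' u' w'))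
    (hd : interior (TrapR p q u w) ∩ interior (TrapR p' q' u' w') = ∅)
    {y y' : ℝ} (hy : y < y') (a1 : u < y) (a2 : u' < y) (a3 : y' < w) (a4 : y' < w') : False := by
  have key : q ≤ p' + 2 * y ∨ q' ≤ p + 2 * y := by
    by_contra hcon
    push Not at hcon
    obtain ⟨c1, c2⟩ := hcon
    obtain ⟨x, x1, x2⟩ := exists_between (show max (p + y) (p' + y) < min (q - y) (q' - y) by
      simp only [max_lt_iff, lt_min_iff]; refine ⟨⟨?_, ?_⟩, ?_, ?_⟩ <;> linarith)
    simp only [max_lt_iff, lt_min_iff] at x1 x2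
    have : (x, y) ∈ (∅ : Set (ℝ × ℝ)) := by
      rw [← hd]
      exact ⟨TrapR_interior _ _ _ _ _ a1 (by simp only; linarith) x1.1 (by simp only; linarith),
        TrapR_interior _ _ _ _ _ a2 (by simp only; linarith) x1.2 (by simp only; linarith)⟩
    exact this
  rcases key with k | k
  · have m1 : (q - y', y') ∈ TrapR p q u w ∪ TrapR p' q' u' w' :=
      Or.inl ⟨by simp only; linarith, by simp only; linarith, by simp only; linarith, by simp only; linarith⟩
    have m2 : (p' + y', y') ∈ TrapR p q u w ∪ TrapR p' q' u' w' :=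
      Or.inr ⟨by simp only; linarith, by simp only; linarith, by simp only; linarith, by simp only; linarith⟩
    rcases mid_mem hc m1 m2 with ⟨b1, b2, b3, b4⟩ | ⟨b1, b2, b3, b4⟩ <;>
      simp only at b1 b2 b3 b4 <;> linarith
  · have m1 : (q' - y', y') ∈ TrapR p q u w ∪ TrapR p' q' u' w' :=
      Or.inr ⟨by simp only; linarith, by simp only; linarith, by simp only; linarith, by simp only; linarith⟩
    have m2 : (p + y', y') ∈ TrapR p q u w ∪ TrapR p' q' u' w' :=
      Or.inl ⟨by simp only; linarith, by simp only; linarith, by simp only; linarith, by simp only; linarith⟩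
    rcases mid_mem hc m1 m2 with ⟨b1, b2, b3, b4⟩ | ⟨b1, b2, b3, b4⟩ <;>
      simp only at b1 b2 b3 b4 <;> linarith

lemma stacked {p q u w p' q' u' w' : ℝ} (h1 : u < w) (h1' : u' < w')
    (h2 : p + 2 * w < q) (h2' : p' + 2 * w' < q')
    (hc : Convex ℝ (TrapR p q u w ∪ TrapR p' q' u' w')) (hle : w ≤ u') :
    w = u' ∧ p = p' ∧ q = q' := by
  have hw : w = u' := by
    by_contra hne
    have hlt := lt_of_le_of_ne hle hne
    have m1 : (p + w, w) ∈ TrapR p q u w ∪ TrapR p' q' u' w' :=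
      Or.inl ⟨by simp only; linarith, by simp only; linarith, by simp only; linarith, by simp only; linarith⟩
    have m2 : (p' + u', u') ∈ TrapR p q u w ∪ TrapR p' q' u' w' :=
      Or.inr ⟨by simp only; linarith, by simp only; linarith, by simp only; linarith, by simp only; linarith⟩
    rcases mid_mem hc m1 m2 with ⟨b1, b2, b3, b4⟩ | ⟨b1, b2, b3, b4⟩ <;>
      simp only at b1 b2 b3 b4 <;> linarith
  subst hw
  obtain ⟨e, he, he1, he2⟩ : ∃ e : ℝ, 0 < e ∧ 3 * e < w - u ∧ 3 * e < w' - w := by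
    obtain ⟨e, e1, e2⟩ := exists_between (show (0 : ℝ) < min (w - u) (w' - w) / 3 by
      apply div_pos _ (by norm_num); rw [lt_min_iff]; constructor <;> linarith)
    refine ⟨e, e1, ?_, ?_⟩
    · have := min_le_left (w - u) (w' - w); linarith
    · have := min_le_right (w - u) (w' - w); linarith
  have L1 : ∀ s, 0 ≤ s → s ≤ 3 * e → (p + (w - s), w - s) ∈ TrapR p q u w ∪ TrapR p' q' w w' :=
    fun s _ _ => Or.inl ⟨by simp only; linarith, by simp only; linarith, by simp only; linarith, by simp only; linarith⟩
  have R1 : ∀ s, 0 ≤ s → s ≤ 3 * e → (q - (w - s), w - s) ∈ TrapR p q u w ∪ TrapR p' q' w w' :=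
    fun s _ _ => Or.inl ⟨by simp only; linarith, by simp only; linarith, by simp only; linarith, by simp only; linarith⟩
  have L2 : ∀ s, 0 ≤ s → s ≤ 3 * e → (p' + (w + s), w + s) ∈ TrapR p q u w ∪ TrapR p' q' w w' :=
    fun s _ _ => Or.inr ⟨by simp only; linarith, by simp only; linarith, by simp only; linarith, by simp only; linarith⟩
  have R2 : ∀ s, 0 ≤ s → s ≤ 3 * e → (q' - (w + s), w + s) ∈ TrapR p q u w ∪ TrapR p' q' w w' :=
    fun s _ _ => Or.inr ⟨by simp only; linarith, by simp only; linarith, by simp only; linarith, by simp only; linarith⟩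
  refine ⟨rfl, ?_, ?_⟩
  · rcases lt_trichotomy p p' with h | h | h
    · exfalso
      rcases mid_mem hc (L1 e he.le (by linarith)) (L2 (3 * e) (by linarith) le_rfl) with ⟨b1, b2, b3, b4⟩ | ⟨b1, b2, b3, b4⟩ <;>
        simp only at b1 b2 b3 b4 <;> linarith
    · exact h
    · exfalso
      rcases mid_mem hc (L1 (3 * e) (by linarith) le_rfl) (L2 e he.le (by linarith)) with ⟨b1, b2, b3, b4⟩ | ⟨b1, b2, b3, b4⟩ <;>
        simp only at b1 b2 b3 b4 <;> linarith
  · rcases lt_trichotomy q q' with h | h | h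
    · exfalso
      rcases mid_mem hc (R1 (3 * e) (by linarith) le_rfl) (R2 e he.le (by linarith)) with ⟨b1, b2, b3, b4⟩ | ⟨b1, b2, b3, b4⟩ <;>
        simp only at b1 b2 b3 b4 <;> linarith
    · exact h
    · exfalso
      rcases mid_mem hc (R1 e he.le (by linarith)) (R2 (3 * e) (by linarith) le_rfl) with ⟨b1, b2, b3, b4⟩ | ⟨b1, b2, b3, b4⟩ <;>
        simp only at b1 b2 b3 b4 <;> linarith

lemma stack_union {p q u w w' : ℝ} (h1 : u < w) (h1' : w < w') :
    TrapR p q u w ∪ TrapR p q w w' = TrapR p q u w' := by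
  ext z
  constructor
  · rintro (⟨a, b, c, d⟩ | ⟨a, b, c, d⟩) <;> exact ⟨by linarith, by linarith, c, d⟩
  · rintro ⟨a, b, c, d⟩
    rcases le_total z.2 w with h | h
    · exact Or.inl ⟨a, h, c, d⟩
    · exact Or.inr ⟨h, b, c, d⟩

/-- A trapezoid whose ratio of the bases is a power of `g`. -/
def Good (g : ℝ) (S : Set (ℝ × ℝ)) : Prop :=
  ∃ (p q u w : ℝ) (k : ℕ), u < w ∧ p + 2 * w < q ∧
    q - p - 2 * w = g ^ (k + 1) * (q - p - 2 * u) ∧ S = TrapR p q u w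

lemma good_union {g : ℝ} {S₁ S₂ : Set (ℝ × ℝ)} (H1 : Good g S₁) (H2 : Good g S₂)
    (hc : Convex ℝ (S₁ ∪ S₂)) (hd : interior S₁ ∩ interior S₂ = ∅) : Good g (S₁ ∪ S₂) := by
  obtain ⟨p, q, u, w, k, h1, h2, h3, rfl⟩ := H1
  obtain ⟨p', q', u', w', k', h1', h2', h3', rfl⟩ := H2
  rcases le_or_gt w u' with h | h
  · obtain ⟨rfl, rfl, rfl⟩ := stacked h1 h1' h2 h2' hc h
    refine ⟨p, q, u, w', k + k' + 1, by linarith, h2', ?_, stack_union h1 h1'⟩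
    rw [h3', h3]; ring
  rcases le_or_gt w' u with h' | h'
  · rw [Set.union_comm] at hc ⊢
    obtain ⟨rfl, rfl, rfl⟩ := stacked h1' h1 h2' h2 hc h'
    refine ⟨p', q', u', w, k + k' + 1, by linarith, h2, ?_, stack_union h1' h1⟩
    rw [h3, h3']; ring
  exfalso
  obtain ⟨y, y1, y2⟩ := exists_between (show max u u' < min w w' by
    simp only [max_lt_iff, lt_min_iff]; exact ⟨⟨h1, h⟩, h', h1'⟩)
  obtain ⟨y', y1', y2'⟩ := exists_between y2
  simp only [max_lt_iff, lt_min_iff] at y1 y2 y2'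
  exact no_overlap h2 h2' hc hd y1' y1.1 y1.2 y2'.1 y2'.2

lemma interior_half {f : ℝ × ℝ →L[ℝ] ℝ} (hf : f ≠ 0) {c : ℝ} {S : Set (ℝ × ℝ)}
    (h : ∀ z ∈ S, c ≤ f z) : ∀ z ∈ interior S, c < f z := by
  have hsur : Function.Surjective f := by
    have : (f : ℝ × ℝ →ₗ[ℝ] ℝ) ≠ 0 := by
      intro h0; apply hf; exact ContinuousLinearMap.coe_injective (by simpa using h0)
    exact LinearMap.surjective this
  have hop := f.isOpenMap hsur
  have e := hop.preimage_interior_eq_interior_preimage f.continuous (Set.Ici c)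
  intro z hz
  have : z ∈ interior (f ⁻¹' Set.Ici c) := interior_mono (fun y hy => h y hy) hz
  rw [← e, interior_Ici] at this
  exact this

lemma side {f : ℝ × ℝ →L[ℝ] ℝ} {c : ℝ} {S₁ S₂ : Set (ℝ × ℝ)}
    (hc : Convex ℝ (S₁ ∪ S₂)) (c1 : IsClosed S₁) (c2 : IsClosed S₂)
    (hl : ∀ z ∈ S₁ ∩ S₂, f z = c) :
    (∀ z ∈ S₁, f z ≤ c) ∨ (∀ z ∈ S₂, f z ≤ c) := by
  by_contra hcon
  push Not at hcon
  obtain ⟨⟨z, hz, hz'⟩, y, hy, hy'⟩ := hcon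
  have hcv : Convex ℝ ((S₁ ∪ S₂) ∩ {z | c < f z}) := by
    apply hc.inter
    exact convex_halfSpace_gt f.isLinear c
  have hp := hcv.isPreconnected
  rw [isPreconnected_closed_iff] at hp
  obtain ⟨x, ⟨hx, hx'⟩, hx1⟩ := hp S₁ S₂ c1 c2 Set.inter_subset_left
    ⟨z, ⟨Or.inl hz, hz'⟩, hz⟩ ⟨y, ⟨Or.inr hy, hy'⟩, hy⟩
  have := hl x hx1
  simp only [Set.mem_ofPred_eq] at hx'
  linarith

lemma half_convex {f : ℝ × ℝ →L[ℝ] ℝ} (hf : f ≠ 0) {c : ℝ} {S₁ S₂ : Set (ℝ × ℝ)}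
    (hc : Convex ℝ (S₁ ∪ S₂)) (c1 : IsClosed S₁)
    (r1 : S₁ ⊆ closure (interior S₁))
    (h1 : ∀ z ∈ S₁, c ≤ f z) (h2 : ∀ z ∈ S₂, f z ≤ c) : Convex ℝ S₁ := by
  have e : S₁ = closure ((S₁ ∪ S₂) ∩ {z | c < f z}) := by
    apply Set.Subset.antisymm
    · refine r1.trans (closure_mono ?_)
      intro z hz
      exact ⟨Or.inl (interior_subset hz), interior_half hf h1 z hz⟩
    · apply closure_minimal _ c1
      rintro z ⟨hz | hz, hz'⟩
      · exact hz
      · exact absurd (h2 z hz) (not_le.2 hz')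
  rw [e]
  exact (hc.inter (convex_halfSpace_gt f.isLinear c)).closure

lemma cut_convex {f : ℝ × ℝ →L[ℝ] ℝ} (hf : f ≠ 0) {c : ℝ} {S₁ S₂ : Set (ℝ × ℝ)}
    (hc : Convex ℝ (S₁ ∪ S₂)) (c1 : IsClosed S₁) (c2 : IsClosed S₂)
    (r1 : S₁ ⊆ closure (interior S₁)) (r2 : S₂ ⊆ closure (interior S₂))
    (n1 : (interior S₁).Nonempty) (n2 : (interior S₂).Nonempty)
    (hl : ∀ z ∈ S₁ ∩ S₂, f z = c) : Convex ℝ S₁ ∧ Convex ℝ S₂ := by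
  have hf' : -f ≠ 0 := neg_ne_zero.2 hf
  have flat : ∀ S : Set (ℝ × ℝ), (interior S).Nonempty → (∀ z ∈ S, f z ≤ c) →
      (∀ z ∈ S, (-f) z ≤ -c) → False := by
    rintro S ⟨z, hz⟩ h h'
    have := interior_half hf (c := c) (S := S) (fun z hz => by have := h' z hz; simpa using this) z hz
    have := h z (interior_subset hz)
    linarith
  have A := side hc c1 c2 hl
  have B := side (f := -f) (c := -c) hc c1 c2 (fun z hz => by simp [hl z hz])
  have hc' : Convex ℝ (S₂ ∪ S₁) := by rwa [Set.union_comm]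
  rcases A with A | A <;> rcases B with B | B
  · exact (flat _ n1 A B).elim
  · have B' : ∀ z ∈ S₂, c ≤ f z := fun z hz => by simpa using B z hz
    exact ⟨half_convex hf' (c := -c) hc c1 r1 (fun z hz => by simpa using A z hz) B,
      half_convex hf hc' c2 r2 B' A⟩
  · have B' : ∀ z ∈ S₁, c ≤ f z := fun z hz => by simpa using B z hz
    exact ⟨half_convex hf hc c1 r1 B' A,
      half_convex hf' (c := -c) hc' c2 r2 (fun z hz => by simpa using A z hz) B⟩
  · exact (flat _ n2 A B).elim

lemma segment_line (x y : ℝ × ℝ) : ∃ (f : ℝ × ℝ →L[ℝ] ℝ) (c : ℝ), f ≠ 0 ∧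
    ∀ z ∈ segment ℝ x y, f z = c := by
  by_cases h : x = y
  · subst h
    refine ⟨ContinuousLinearMap.fst ℝ ℝ ℝ, x.1, ?_, ?_⟩
    · intro h
      have := congrArg (fun l => l ((1 : ℝ), (0 : ℝ))) h
      simp at this
    · intro z hz
      rw [segment_same] at hz
      rw [Set.mem_singleton_iff.1 hz]; rfl
  · refine ⟨(y.2 - x.2) • ContinuousLinearMap.fst ℝ ℝ ℝ - (y.1 - x.1) • ContinuousLinearMap.snd ℝ ℝ ℝ,
      (y.2 - x.2) * x.1 - (y.1 - x.1) * x.2, ?_, ?_⟩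
    · intro h0
      apply h
      have e1 := congrArg (fun l => l ((1 : ℝ), (0 : ℝ))) h0
      have e2 := congrArg (fun l => l ((0 : ℝ), (1 : ℝ))) h0
      simp at e1 e2
      ext <;> linarith
    · rintro z ⟨s, t, hs, ht, hst, rfl⟩
      have e : s = 1 - t := by linarith
      subst e
      simp
      ring

lemma tiling_inv {a : ℝ} (ha : 1 < a) {S : Set (ℝ × ℝ)} (h : TrivialTiling {stdTrap a} S) :
    IsClosed S ∧ S ⊆ closure (interior S) ∧ (interior S).Nonempty ∧
      (Convex ℝ S → Good (Gfun a) S) := by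
  induction h with
  | single r v t hr ht =>
    rw [Set.mem_singleton_iff.1 ht, stdTrap_eq a ha, homothety_TrapR r hr]
    have hlt : r * 1 < r * a := by nlinarith
    have hn : (interior (TrapR (r * 0 + v.1 - v.2) (r * (a + 1) + v.1 + v.2) (r * 0 + v.2)
        (r * 1 + v.2))).Nonempty :=
      ⟨(r * (a + 1) / 2 + v.1, r / 2 + v.2), TrapR_interior _ _ _ _ _ (by simp only; linarith)
        (by simp only; linarith) (by simp only; linarith) (by simp only; linarith)⟩
    refine ⟨TrapR_closed _ _ _ _, ?_, hn, fun _ => ?_⟩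
    · rw [(TrapR_convex _ _ _ _).closure_interior_eq_closure_of_nonempty_interior hn]
      exact subset_closure
    · refine ⟨_, _, _, _, 0, ?_, ?_, ?_, rfl⟩
      · linarith
      · linarith
      · have : a + 1 ≠ 0 := by linarith
        have e : Gfun a * (a + 1) = a - 1 := by unfold Gfun; exact div_mul_cancel₀ _ this
        linear_combination (-r) * e
  | split S S₁ S₂ x y _ _ hS hd hseg ih1 ih2 =>
    obtain ⟨c1, r1, n1, g1⟩ := ih1
    obtain ⟨c2, r2, n2, g2⟩ := ih2
    subst hS
    refine ⟨c1.union c2, ?_, ?_, ?_⟩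
    · apply Set.union_subset
      · exact r1.trans (closure_mono (interior_mono Set.subset_union_left))
      · exact r2.trans (closure_mono (interior_mono Set.subset_union_right))
    · exact n1.mono (interior_mono Set.subset_union_left)
    · intro hc
      obtain ⟨f, c, hf, hfc⟩ := segment_line x y
      obtain ⟨v1, v2⟩ := cut_convex hf hc c1 c2 r1 r2 n1 n2 (fun z hz => hfc z (hseg hz))
      exact good_union (g1 v1) (g2 v2) hc hd

lemma TrapR_inj {p q u w p' q' u' w' : ℝ} (h1 : u < w) (h1' : u' < w')
    (h2 : p + 2 * w < q) (h2' : p' + 2 * w' < q') (h : TrapR p q u w = TrapR p' q' u' w') :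
    p' ≤ p ∧ q ≤ q' ∧ u' ≤ u ∧ w ≤ w' := by
  have m1 : (p + u, u) ∈ TrapR p q u w :=
    ⟨by simp only; linarith, by simp only; linarith, by simp only; linarith, by simp only; linarith⟩
  have m2 : (q - w, w) ∈ TrapR p q u w :=
    ⟨by simp only; linarith, by simp only; linarith, by simp only; linarith, by simp only; linarith⟩
  rw [h] at m1 m2
  obtain ⟨b1, b2, b3, b4⟩ := m1
  obtain ⟨d1, d2, d3, d4⟩ := m2
  simp only at b1 b2 b3 b4 d1 d2 d3 d4
  refine ⟨?_, ?_, ?_, ?_⟩ <;> linarith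

lemma G_pow {a b : ℝ} (ha : 1 < a) (hb : 1 < b) (h : TrivialTiling {stdTrap a} (stdTrap b)) :
    ∃ k : ℕ, Gfun b = Gfun a ^ (k + 1) := by
  obtain ⟨-, -, -, g⟩ := tiling_inv ha h
  obtain ⟨p, q, u, w, k, h1, h2, h3, h4⟩ := g (convex_convexHull _ _)
  rw [stdTrap_eq b hb] at h4
  obtain ⟨a1, a2, a3, a4⟩ := TrapR_inj (by norm_num) h1 (by linarith) h2 h4
  obtain ⟨b1, b2, b3, b4⟩ := TrapR_inj h1 (by norm_num) h2 (by linarith) h4.symm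
  have hp : p = 0 := by linarith
  have hq : q = b + 1 := by linarith
  have hu : u = 0 := by linarith
  have hw : w = 1 := by linarith
  subst hp hq hu hw
  refine ⟨k, ?_⟩
  have : b + 1 ≠ 0 := by linarith
  rw [Gfun, div_eq_iff this]
  linarith

/-- `y` is conjugate to `x` with respect to `√d = s`. -/
def Cj (s x y : ℝ) : Prop := ∃ p q : ℚ, x = p + q * s ∧ y = p - q * s

lemma Cj.mul {d : ℚ} (hd : 0 < d) {x y x' y' : ℝ} (h : Cj (Real.sqrt d) x y)
    (h' : Cj (Real.sqrt d) x' y') : Cj (Real.sqrt d) (x * x') (y * y') := by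
  obtain ⟨p, q, rfl, rfl⟩ := h
  obtain ⟨p', q', rfl, rfl⟩ := h'
  have hs : Real.sqrt d * Real.sqrt d = d := Real.mul_self_sqrt (by exact_mod_cast hd.le)
  refine ⟨p * p' + q * q' * d, p * q' + q * p', ?_, ?_⟩ <;> push_cast <;> linear_combination (q * q' : ℝ) * hs

lemma Cj.sub {s x y x' y' : ℝ} (h : Cj s x y) (h' : Cj s x' y') : Cj s (x - x') (y - y') := by
  obtain ⟨p, q, rfl, rfl⟩ := h
  obtain ⟨p', q', rfl, rfl⟩ := h'
  refine ⟨p - p', q - q', ?_, ?_⟩ <;> push_cast <;> ring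

lemma Cj.rat {s : ℝ} (r : ℚ) : Cj s r r := ⟨r, 0, by simp, by simp⟩

lemma Cj.pow {d : ℚ} (hd : 0 < d) {x y : ℝ} (h : Cj (Real.sqrt d) x y) (n : ℕ) :
    Cj (Real.sqrt d) (x ^ n) (y ^ n) := by
  induction n with
  | zero => simpa using Cj.rat (s := Real.sqrt d) 1
  | succ n ih => rw [pow_succ, pow_succ]; exact ih.mul hd h

lemma Cj.zero {s y : ℝ} (hs : Irrational s) (h : Cj s 0 y) : y = 0 := by
  obtain ⟨p, q, h1, rfl⟩ := h
  by_cases hq : q = 0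
  · subst hq; simp at h1 ⊢; exact_mod_cast h1.symm
  · exfalso
    apply hs
    refine ⟨-p / q, ?_⟩
    have : (q : ℝ) ≠ 0 := by exact_mod_cast hq
    push_cast
    field_simp
    linarith

/-- the inequality `(ii)` for the explicit sequence. -/
lemma ratio_ineq {A B : ℝ} (hB : 1 < B) (hAB : B < A) (n : ℕ) :
    ∃ x y : ℝ, 1 < y ∧ y < x ∧ B * x ≤ A * y ∧ Gfun x = Gfun A ^ (n + 1) ∧
      Gfun y = Gfun B ^ (n + 1) := by
  induction n with
  | zero => exact ⟨A, B, hB, hAB, by linarith, by simp, by simp⟩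
  | succ n ih =>
    obtain ⟨x, y, hy, hxy, hle, hx, hy'⟩ := ih
    have hA : 1 < A := hB.trans hAB
    have hx1 : 1 < x := hy.trans hxy
    have p1 : 0 < A + x := by linarith
    have p2 : 0 < B + y := by linarith
    have i1 : 0 < (y - 1) * (B - 1) := mul_pos (by linarith) (by linarith)
    have i2 : 0 < (x - 1) * (A - 1) := mul_pos (by linarith) (by linarith)
    have step : ∀ A x : ℝ, 1 < A → 1 < x → Gfun ((1 + A * x) / (A + x)) = Gfun x * Gfun A := by
      intro A x hA hx
      have e1 : A + x ≠ 0 := by linarith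
      have e2 : A + 1 ≠ 0 := by linarith
      have e3 : x + 1 ≠ 0 := by linarith
      have e4 : (1 + A * x) / (A + x) + 1 ≠ 0 := by
        have : 0 < (1 + A * x) / (A + x) := by apply div_pos <;> nlinarith
        linarith
      rw [Gfun, div_eq_iff e4, Gfun, Gfun]
      field_simp
      ring
    refine ⟨(1 + A * x) / (A + x), (1 + B * y) / (B + y), ?_, ?_, ?_, ?_, ?_⟩
    · rw [lt_div_iff₀ p2]; nlinarith
    · rw [div_lt_div_iff₀ p2 p1]
      have j1 : 0 < (A - B) * (y * x - 1) := mul_pos (by linarith) (by nlinarith)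
      have j2 : 0 < (x - y) * (A * B - 1) := mul_pos (by linarith) (by nlinarith)
      nlinarith
    · rw [← mul_div_assoc, ← mul_div_assoc, div_le_div_iff₀ p1 p2]
      have j1 : 0 ≤ A * B * (A * y - B * x) := mul_nonneg (by positivity) (by linarith)
      have j2 : 0 ≤ A * x - B * y := by nlinarith
      have j3 : 0 ≤ A ^ 2 - B ^ 2 := by nlinarith
      nlinarith
    · rw [step A x hA hx1, hx]; ring
    · rw [step B y hB hy, hy']; ring

lemma G_inj {x y : ℝ} (hx : x + 1 ≠ 0) (hy : y + 1 ≠ 0) (h : Gfun x = Gfun y) : x = y := by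
  rw [Gfun, Gfun, div_eq_div_iff hx hy] at h
  linarith

/-- **Necessary conditions for trivial tilings (theorem on logarithms).**
If `a, b ∈ ℚ[√d]` with `1 < ā < a`, `b > 1`, and `t(b)` admits a trivial tiling by homothetic
copies of `t(a)`, then `1 < b̄ < b`, `b̄/b ≥ ā/a`, and
`ln G(b)/ln G(b̄) ≥ ln G(a)/ln G(ā)` where `G(x) = (x-1)/(x+1)`. -/
theorem statement3 (d : ℚ) (hd : 0 < d) (hirr : Irrational (Real.sqrt d))
    (pa qa pb qb : ℚ) (a abar b bbar : ℝ)
    (hae : a = pa + qa * Real.sqrt d) (habar : abar = pa - qa * Real.sqrt d)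
    (hbe : b = pb + qb * Real.sqrt d) (hbbar : bbar = pb - qb * Real.sqrt d)
    (ha1 : 1 < abar) (ha2 : abar < a) (hb1 : 1 < b)
    (htile : TrivialTiling {stdTrap a} (stdTrap b)) :
    (1 < bbar ∧ bbar < b) ∧
    abar / a ≤ bbar / b ∧
    Real.log (Gfun a) / Real.log (Gfun abar) ≤ Real.log (Gfun b) / Real.log (Gfun bbar) := by
  have ha : 1 < a := ha1.trans ha2
  obtain ⟨k, hk⟩ := G_pow ha hb1 htile
  have Ca : Cj (Real.sqrt d) a abar := ⟨pa, qa, hae, habar⟩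
  have Cb : Cj (Real.sqrt d) b bbar := ⟨pb, qb, hbe, hbbar⟩
  have C1 : Cj (Real.sqrt d) 1 1 := by simpa using Cj.rat (s := Real.sqrt d) 1
  have Cm1 : Cj (Real.sqrt d) (-1) (-1) := by simpa using Cj.rat (s := Real.sqrt d) (-1)
  have hcj := ((Cb.sub C1).mul hd ((Ca.sub Cm1).pow hd (k + 1))).sub
    (((Ca.sub C1).pow hd (k + 1)).mul hd (Cb.sub Cm1))
  have hb0 : b + 1 ≠ 0 := by linarith
  have ha0 : a + 1 ≠ 0 := by linarith
  have hab0 : abar + 1 ≠ 0 := by linarith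
  have hz : (b - 1) * (a - -1) ^ (k + 1) - (a - 1) ^ (k + 1) * (b - -1) = 0 := by
    rw [Gfun, Gfun, div_pow, div_eq_div_iff hb0 (pow_ne_zero _ ha0)] at hk
    simp only [sub_neg_eq_add]
    linarith
  rw [hz] at hcj
  have hbar := hcj.zero hirr
  simp only [sub_neg_eq_add] at hbar
  have hbb0 : bbar + 1 ≠ 0 := by
    intro h0
    have e : bbar = -1 := by linarith
    rw [e] at hbar
    have := pow_ne_zero (k + 1) hab0
    norm_num at hbar
    exact hab0 hbar
  have hkbar : Gfun bbar = Gfun abar ^ (k + 1) := by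
    rw [Gfun, Gfun, div_pow, div_eq_div_iff hbb0 (pow_ne_zero _ hab0)]
    linarith
  obtain ⟨x, y, hy, hxy, hle, hx, hy'⟩ := ratio_ineq ha1 ha2 k
  have ex : b = x := G_inj hb0 (by linarith) (hk.trans hx.symm)
  have ey : bbar = y := G_inj hbb0 (by linarith) (hkbar.trans hy'.symm)
  rw [← ex, ← ey] at hle
  rw [← ey] at hy hxy
  rw [← ex] at hxy
  refine ⟨⟨hy, hxy⟩, ?_, ?_⟩
  · rw [div_le_div_iff₀ (by linarith) (by linarith)]
    linarith
  · rw [hk, hkbar, Real.log_pow, Real.log_pow,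
      mul_div_mul_left _ _ (by positivity : ((k + 1 : ℕ) : ℝ) ≠ 0)]
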